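/- Let H be a complex Hilbert space with dim H ≥ 2 and let φ: P(H) → P(H) be a surjective map such that ‖φ(P) − φ(Q)‖ ≥ ‖P − Q‖ for every pair P, Q ∈ P(H). Then φ is a Wigner symmetry. -/

import Mathlib

open scoped InnerProductSpace ComplexConjugate

variable {H : Type*} [NormedAddCommGroup H] [InnerProductSpace ℂ H] [CompleteSpace H]

/-- The rank-one (orthogonal) projection onto the span of a unit vector `v`,
i.e. `x ↦ ⟪v, x⟫ • v`. -/
noncomputable def rankOneProj (v : H) : H →L[ℂ] H :=
  (innerSL ℂ v).smulRight v

/-- A rank-one projection: a self-adjoint idempotent bounded operator with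
one-dimensional range. -/
def IsRankOneProjection (P : H →L[ℂ] H) : Prop :=
  IsSelfAdjoint P ∧ P ∘L P = P ∧ Module.finrank ℂ (LinearMap.range (P : H →ₗ[ℂ] H)) = 1

/-- `φ` is a Wigner symmetry: there is a unitary or antiunitary operator `U` on `H`
(an additive, norm-preserving, surjective map that is `ℂ`-linear or conjugate-linear)
such that `φ P = U P U*` for every rank-one projection `P`; equivalently, `φ` sends the
projection onto `ℂv` to the projection onto `ℂ(Uv)` for every unit vector `v`. -/
def IsWignerSymmetry
    (φ : {P : H →L[ℂ] H // IsRankOneProjection P} → {P : H →L[ℂ] H // IsRankOneProjection P}) :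
    Prop :=
  ∃ U : H → H,
    (∀ x y, U (x + y) = U x + U y) ∧
    (∀ x, ‖U x‖ = ‖x‖) ∧
    Function.Surjective U ∧
    ((∀ (c : ℂ) (x : H), U (c • x) = c • U x) ∨
      (∀ (c : ℂ) (x : H), U (c • x) = (starRingEnd ℂ) c • U x)) ∧
    (∀ (v : H), ‖v‖ = 1 → ∀ P : {P : H →L[ℂ] H // IsRankOneProjection P},
      P.1 = rankOneProj v → (φ P).1 = rankOneProj (U v))

section Circle

/-- An injective nonexpansive self-map of the unit circle is surjective. -/
theorem exists_preimage_of_injective_on_circle (f : ℂ → ℂ)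
    (hf : ∀ z, ‖z‖ = 1 → ‖f z‖ = 1)
    (hlip : ∀ z w, ‖z‖ = 1 → ‖w‖ = 1 → ‖f z - f w‖ ≤ ‖z - w‖)
    (hinj : ∀ z w, ‖z‖ = 1 → ‖w‖ = 1 → f z = f w → z = w)
    {c : ℂ} (hc : ‖c‖ = 1) : ∃ z, ‖z‖ = 1 ∧ f z = c := by
  by_contra! hne
  have hc0 : c ≠ 0 := by rintro rfl; simp at hc
  let E : ℝ → ℂ := fun t => Complex.exp (t * Complex.I)
  have hE : ∀ t, ‖E t‖ = 1 := fun t => Complex.norm_exp_ofReal_mul_I t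
  have hEc : Continuous E := by fun_prop
  have hfE : Continuous fun t => f (E t) := by
    rw [continuous_iff_continuousAt]
    intro t
    have h0 : Filter.Tendsto (fun s => ‖E s - E t‖) (nhds t) (nhds 0) := by
      have : Continuous fun s => ‖E s - E t‖ := by fun_prop
      simpa using this.tendsto t
    exact tendsto_iff_norm_sub_tendsto_zero.2
      (squeeze_zero (fun _ => norm_nonneg _) (fun s => hlip _ _ (hE s) (hE t)) h0)
  let g : ℝ → ℂ := fun t => -(f (E t) / c)
  have hg : Continuous g := (hfE.div_const c).neg
  have hgn : ∀ t, ‖g t‖ = 1 := fun t => by simp [g, hf _ (hE t), hc]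
  have hslit : ∀ t, g t ∈ Complex.slitPlane := by
    intro t
    by_contra h
    rw [Complex.mem_slitPlane_iff, not_or, not_lt, not_not] at h
    have h1 : g t = ((g t).re : ℂ) := Complex.ext rfl (by simpa using h.2)
    have h2 : |(g t).re| = 1 := by
      have := hgn t
      rw [h1] at this
      simpa using this
    rw [abs_of_nonpos h.1] at h2
    have h3 : g t = -1 := by
      rw [h1, show (g t).re = -1 by linarith]; simp
    have h4 : f (E t) / c = 1 := neg_injective h3
    exact hne _ (hE t) ((div_eq_one_iff_eq hc0).1 h4)
  let h : ℝ → ℝ := fun t => (g t).arg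
  have hh : Continuous h := continuous_iff_continuousAt.2 fun t =>
    (Complex.continuousAt_arg (hslit t)).comp hg.continuousAt
  have hhinj : ∀ s t, h s = h t → E s = E t := by
    intro s t hst
    have h1 : g s = g t := Complex.ext_norm_arg (by rw [hgn, hgn]) hst
    have h2 : f (E s) = f (E t) := (div_left_inj' hc0).1 (neg_injective h1)
    exact hinj _ _ (hE s) (hE t) h2
  have hEpi : ∀ t, E (t + Real.pi) = -E t := fun t => by
    simp [E, add_mul, Complex.exp_add, Complex.exp_pi_mul_I]
  let k : ℝ → ℝ := fun t => h t - h (t + Real.pi)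
  have hk : Continuous k := by fun_prop
  have hper : h (0 + Real.pi + Real.pi) = h 0 := by
    simp only [h, g, hEpi, neg_neg]
  have hkpi : k (0 + Real.pi) = -k 0 := by
    simp only [k, hper]; ring
  obtain ⟨t, -, ht⟩ : (0 : ℝ) ∈ k '' Set.uIcc 0 (0 + Real.pi) := by
    apply intermediate_value_uIcc hk.continuousOn
    rw [hkpi, Set.mem_uIcc]
    rcases le_total 0 (k 0) with h0 | h0
    · right; constructor <;> linarith
    · left; constructor <;> linarith
  have h1 := hhinj _ _ (sub_eq_zero.1 ht)
  rw [hEpi] at h1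
  have h2 : E t = 0 := self_eq_neg.1 h1
  have := hE t
  simp [h2] at this

end Circle

section Wigner

variable {E : Type*} [NormedAddCommGroup E] [InnerProductSpace ℂ E]

theorem inner_self_eq_ofReal_norm_sq (x : E) : ⟪x, x⟫_ℂ = ((‖x‖ ^ 2 : ℝ) : ℂ) := by
  simp [inner_self_eq_norm_sq_to_K]

theorem exists_phase_smul_eq_of_norm_inner_eq {v w : E} (hn : ‖v‖ = ‖w‖)
    (h : ‖⟪v, w⟫_ℂ‖ = ‖v‖ ^ 2) : ∃ c : ℂ, ‖c‖ = 1 ∧ w = c • v := by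
  by_cases hv : v = 0
  · subst hv
    exact ⟨1, by simp, by rw [norm_zero] at hn; simpa using hn.symm⟩
  have hw : w ≠ 0 := by
    rw [← norm_ne_zero_iff, ← hn]; exact norm_ne_zero_iff.2 hv
  have h1 : ‖⟪v, w⟫_ℂ‖ = ‖v‖ * ‖w‖ := by rw [h, ← hn, sq]
  have hv' := norm_ne_zero_iff.2 hv
  obtain ⟨-, c, -, rfl⟩ := (norm_inner_div_norm_mul_norm_eq_one_iff (𝕜 := ℂ) v w).1 (by
    rw [norm_div, h1]
    simp [hv, hw])
  refine ⟨c, ?_, rfl⟩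
  rw [norm_smul] at hn
  exact mul_right_cancel₀ hv' (by rw [← hn, one_mul])

theorem re_inner_eq_of_norm_one_add_eq {u w : ℂ} (h : ‖u‖ = ‖w‖) (h1 : ‖1 + u‖ = ‖1 + w‖) :
    u.re = w.re := by
  have h2 := congrArg (· ^ 2) h
  have h3 := congrArg (· ^ 2) h1
  simp only [← Complex.normSq_eq_norm_sq, Complex.normSq_apply, Complex.add_re, Complex.add_im,
    Complex.one_re, Complex.one_im] at h2 h3
  linarith

section RealIsometry

variable {e : E} {T : E → E}

/-- A map on `e^⊥` preserving the real part of the inner product is additive. -/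
theorem map_add_of_re_inner_eq
    (hT : ∀ x y, ⟪e, x⟫_ℂ = 0 → ⟪e, y⟫_ℂ = 0 → (⟪T x, T y⟫_ℂ).re = (⟪x, y⟫_ℂ).re)
    {x y : E} (hx : ⟪e, x⟫_ℂ = 0) (hy : ⟪e, y⟫_ℂ = 0) : T (x + y) = T x + T y := by
  have hxy : ⟪e, x + y⟫_ℂ = 0 := by rw [inner_add_right, hx, hy, add_zero]
  rw [← sub_eq_zero, ← norm_eq_zero, ← sq_eq_zero_iff, ← inner_self_eq_norm_sq (𝕜 := ℂ)]
  simp only [RCLike.re_to_complex, inner_sub_left, inner_sub_right, inner_add_left,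
    inner_add_right, Complex.sub_re, Complex.add_re, hT _ _ hxy hxy, hT _ _ hx hxy, hT _ _ hxy hx,
    hT _ _ hy hxy, hT _ _ hxy hy, hT _ _ hx hx, hT _ _ hx hy, hT _ _ hy hx, hT _ _ hy hy]
  ring

/-- A map on `e^⊥` preserving the real part of the inner product is real-homogeneous. -/
theorem map_ofReal_smul_of_re_inner_eq
    (hT : ∀ x y, ⟪e, x⟫_ℂ = 0 → ⟪e, y⟫_ℂ = 0 → (⟪T x, T y⟫_ℂ).re = (⟪x, y⟫_ℂ).re)
    {x : E} (hx : ⟪e, x⟫_ℂ = 0) (r : ℝ) : T ((r : ℂ) • x) = (r : ℂ) • T x := by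
  have hrx : ⟪e, (r : ℂ) • x⟫_ℂ = 0 := by rw [inner_smul_right, hx, mul_zero]
  rw [← sub_eq_zero, ← norm_eq_zero, ← sq_eq_zero_iff, ← inner_self_eq_norm_sq (𝕜 := ℂ)]
  simp only [RCLike.re_to_complex, inner_sub_left, inner_sub_right, inner_smul_left,
    inner_smul_right, Complex.sub_re, Complex.conj_ofReal, Complex.re_ofReal_mul,
    hT _ _ hrx hrx, hT _ _ hx hrx, hT _ _ hrx hx, hT _ _ hx hx]
  ring

/-- A map on `e^⊥` preserving the real part and the modulus of the inner product is linear or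
conjugate-linear. -/
theorem exists_ringHom_map_smul
    (hT : ∀ x y, ⟪e, x⟫_ℂ = 0 → ⟪e, y⟫_ℂ = 0 → (⟪T x, T y⟫_ℂ).re = (⟪x, y⟫_ℂ).re)
    (hTn : ∀ x y, ⟪e, x⟫_ℂ = 0 → ⟪e, y⟫_ℂ = 0 → ‖⟪T x, T y⟫_ℂ‖ = ‖⟪x, y⟫_ℂ‖) :
    ∃ σ : ℂ →+* ℂ, (σ = RingHom.id ℂ ∨ σ = starRingEnd ℂ) ∧
      ∀ (c : ℂ) (x : E), ⟪e, x⟫_ℂ = 0 → T (c • x) = σ c • T x := by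
  have hI : ∀ x, ⟪e, x⟫_ℂ = 0 → ⟪e, Complex.I • x⟫_ℂ = 0 := fun x hx => by
    rw [inner_smul_right, hx, mul_zero]
  have hnorm : ∀ x, ⟪e, x⟫_ℂ = 0 → ‖T x‖ = ‖x‖ := fun x hx => by
    have := hTn x x hx hx
    simpa [inner_self_eq_norm_sq_to_K] using this
  have hpm : ∀ x, ⟪e, x⟫_ℂ = 0 →
      T (Complex.I • x) = Complex.I • T x ∨ T (Complex.I • x) = -(Complex.I • T x) := by
    intro x hx
    obtain ⟨c, hc, h⟩ := exists_phase_smul_eq_of_norm_inner_eq (v := T x) (w := T (Complex.I • x))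
      (by rw [hnorm _ hx, hnorm _ (hI x hx), norm_smul]; simp)
      (by rw [hTn _ _ hx (hI x hx), hnorm _ hx]
          simp [inner_self_eq_norm_sq_to_K])
    by_cases hx0 : x = 0
    · have : T x = 0 := by rw [← norm_eq_zero, hnorm _ hx, hx0, norm_zero]
      left; rw [h, this]; simp
    have hre := hT _ _ hx (hI x hx)
    rw [h, inner_smul_right, inner_smul_right, inner_self_eq_ofReal_norm_sq,
      inner_self_eq_ofReal_norm_sq, hnorm _ hx, Complex.re_mul_ofReal, Complex.re_mul_ofReal,
      Complex.I_re, zero_mul] at hre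
    have hc0 : c.re = 0 := by
      have h0 : ‖x‖ ≠ 0 := norm_ne_zero_iff.2 hx0
      exact (mul_eq_zero.1 hre).resolve_right (pow_ne_zero 2 h0)
    have him : c.im * c.im = 1 := by
      have : Complex.normSq c = 1 := by rw [Complex.normSq_eq_norm_sq, hc]; norm_num
      rw [Complex.normSq_apply, hc0] at this
      linarith
    rcases mul_self_eq_one_iff.1 him with h1 | h1
    · left; rw [h, show c = Complex.I from Complex.ext (by simpa using hc0) (by simpa using h1)]
    · right
      rw [h, show c = -Complex.I from Complex.ext (by simpa using hc0) (by simpa using h1),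
        neg_smul]
  have hdich : (∀ x, ⟪e, x⟫_ℂ = 0 → T (Complex.I • x) = Complex.I • T x) ∨
      (∀ x, ⟪e, x⟫_ℂ = 0 → T (Complex.I • x) = -(Complex.I • T x)) := by
    by_contra! hcon
    obtain ⟨⟨x, hx, hx1⟩, y, hy, hy1⟩ := hcon
    have hx2 := (hpm x hx).resolve_left hx1
    have hy2 := (hpm y hy).resolve_right hy1
    have hxy : ⟪e, x + y⟫_ℂ = 0 := by rw [inner_add_right, hx, hy, add_zero]
    have h := hpm _ hxy
    rw [smul_add, map_add_of_re_inner_eq hT (hI x hx) (hI y hy), map_add_of_re_inner_eq hT hx hy,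
      hx2, hy2, smul_add] at h
    rcases h with h | h
    · exact hx1 (hx2.trans (add_right_cancel h))
    · rw [neg_add] at h
      exact hy1 (hy2.trans (add_left_cancel h))
  have hdec : ∀ (c : ℂ) (x : E), ⟪e, x⟫_ℂ = 0 →
      T (c • x) = (c.re : ℂ) • T x + (c.im : ℂ) • T (Complex.I • x) := by
    intro c x hx
    conv_lhs => rw [← Complex.re_add_im c, add_smul, mul_smul]
    rw [map_add_of_re_inner_eq hT, map_ofReal_smul_of_re_inner_eq hT hx,
      map_ofReal_smul_of_re_inner_eq hT (hI x hx)]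
    · rw [inner_smul_right, hx, mul_zero]
    · rw [inner_smul_right, hI x hx, mul_zero]
  rcases hdich with h | h
  · refine ⟨RingHom.id ℂ, Or.inl rfl, fun c x hx => ?_⟩
    rw [hdec c x hx, h x hx, smul_smul, ← add_smul, Complex.re_add_im, RingHom.id_apply]
  · refine ⟨starRingEnd ℂ, Or.inr rfl, fun c x hx => ?_⟩
    rw [hdec c x hx, h x hx, smul_neg, smul_smul, ← sub_eq_add_neg, ← sub_smul]
    congr 1
    apply Complex.ext <;> simp

end RealIsometry

/-- The **Wigner theorem** for maps that are surjective up to a phase. -/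
theorem exists_wigner_operator {e : E} (he : ‖e‖ = 1) (F : E → E)
    (hF : ∀ x y, ‖⟪F x, F y⟫_ℂ‖ = ‖⟪x, y⟫_ℂ‖)
    (hsurj : ∀ w, ∃ (v : E) (c : ℂ), ‖c‖ = 1 ∧ F v = c • w) :
    ∃ U : E → E,
      (∀ x y, U (x + y) = U x + U y) ∧
      (∀ x, ‖U x‖ = ‖x‖) ∧
      Function.Surjective U ∧
      ((∀ (c : ℂ) (x : E), U (c • x) = c • U x) ∨
        (∀ (c : ℂ) (x : E), U (c • x) = (starRingEnd ℂ) c • U x)) ∧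
      ∀ v, ∃ c : ℂ, ‖c‖ = 1 ∧ U v = c • F v := by
  have hFn : ∀ x, ‖F x‖ = ‖x‖ := fun x => by
    have := hF x x
    simpa [inner_self_eq_norm_sq_to_K] using this
  have hself : ∀ {u : E}, ‖u‖ = 1 → ⟪u, u⟫_ℂ = 1 := fun {u} hu => by
    simp [inner_self_eq_norm_sq_to_K, hu]
  set e' := F e with he'
  have he'n : ‖e'‖ = 1 := by rw [he', hFn, he]
  have hc : ∀ x, ⟪e, x⟫_ℂ = 0 → ‖⟪e', F (e + x)⟫_ℂ‖ = 1 := fun x hx => by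
    rw [he', hF, inner_add_right, hx, add_zero, hself he, norm_one]
  let T : E → E := fun x => (⟪e', F (e + x)⟫_ℂ)⁻¹ • F (e + x) - e'
  have hTe : ∀ x, e' + T x = (⟪e', F (e + x)⟫_ℂ)⁻¹ • F (e + x) := fun x => by simp [T]
  have hTperp : ∀ x, ⟪e, x⟫_ℂ = 0 → ⟪e', T x⟫_ℂ = 0 := fun x hx => by
    have : ⟪e', F (e + x)⟫_ℂ ≠ 0 := by rw [← norm_ne_zero_iff, hc x hx]; exact one_ne_zero
    simp only [T]
    rw [inner_sub_right, inner_smul_right, inv_mul_cancel₀ this, hself he'n, sub_self]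
  have hperp_symm : ∀ {u w : E}, ⟪u, w⟫_ℂ = 0 → ⟪w, u⟫_ℂ = 0 := fun h => inner_eq_zero_symm.1 h
  have hexp : ∀ {u x y : E}, ‖u‖ = 1 → ⟪u, x⟫_ℂ = 0 → ⟪u, y⟫_ℂ = 0 →
      ⟪u + x, u + y⟫_ℂ = 1 + ⟪x, y⟫_ℂ := fun {u x y} hu hx hy => by
    rw [inner_add_left, inner_add_right, inner_add_right, hself hu, hy, hperp_symm hx]; ring
  have hT1 : ∀ x y, ⟪e, x⟫_ℂ = 0 → ⟪e, y⟫_ℂ = 0 → ‖1 + ⟪T x, T y⟫_ℂ‖ = ‖1 + ⟪x, y⟫_ℂ‖ := by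
    intro x y hx hy
    rw [← hexp he'n (hTperp x hx) (hTperp y hy), ← hexp he hx hy, hTe, hTe, inner_smul_left,
      inner_smul_right, norm_mul, norm_mul, RCLike.norm_conj, norm_inv, norm_inv, hc x hx, hc y hy,
      hF]
    simp
  have hTnorm : ∀ x, ⟪e, x⟫_ℂ = 0 → ‖T x‖ = ‖x‖ := by
    intro x hx
    have h := hT1 x x hx hx
    rw [inner_self_eq_ofReal_norm_sq, inner_self_eq_ofReal_norm_sq, ← Complex.ofReal_one,
      ← Complex.ofReal_add, ← Complex.ofReal_add, Complex.norm_real, Complex.norm_real,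
      Real.norm_eq_abs, Real.norm_eq_abs] at h
    rw [abs_of_nonneg (by positivity), abs_of_nonneg (by positivity)] at h
    exact (sq_eq_sq₀ (norm_nonneg _) (norm_nonneg _)).1 (by linarith)
  have hTF : ∀ x, ⟪e, x⟫_ℂ = 0 → ∃ c : ℂ, ‖c‖ = 1 ∧ T x = c • F x := by
    intro x hx
    apply exists_phase_smul_eq_of_norm_inner_eq
    · rw [hFn, hTnorm x hx]
    · have h0 : ⟪F x, e'⟫_ℂ = 0 := by
        rw [← norm_eq_zero, he', hF, hperp_symm hx, norm_zero]
      simp only [T]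
      rw [inner_sub_right, h0, sub_zero, inner_smul_right, norm_mul, norm_inv, hc x hx, hF,
        inner_add_right, hperp_symm hx, hFn]
      simp [inner_self_eq_norm_sq_to_K]
  have hTn : ∀ x y, ⟪e, x⟫_ℂ = 0 → ⟪e, y⟫_ℂ = 0 → ‖⟪T x, T y⟫_ℂ‖ = ‖⟪x, y⟫_ℂ‖ := by
    intro x y hx hy
    obtain ⟨c, hc1, hcx⟩ := hTF x hx
    obtain ⟨d, hd1, hdy⟩ := hTF y hy
    rw [hcx, hdy, inner_smul_left, inner_smul_right, norm_mul, norm_mul, RCLike.norm_conj, hc1,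
      hd1, hF, one_mul, one_mul]
  have hTre : ∀ x y, ⟪e, x⟫_ℂ = 0 → ⟪e, y⟫_ℂ = 0 → (⟪T x, T y⟫_ℂ).re = (⟪x, y⟫_ℂ).re :=
    fun x y hx hy => re_inner_eq_of_norm_one_add_eq (hTn x y hx hy) (hT1 x y hx hy)
  have hTsurj : ∀ y, ⟪e', y⟫_ℂ = 0 → ∃ x, ⟪e, x⟫_ℂ = 0 ∧ T x = y := by
    intro y hy
    obtain ⟨v, c, hc1, hv⟩ := hsurj (e' + y)
    have hl : ‖⟪e, v⟫_ℂ‖ = 1 := by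
      rw [← hF, ← he', hv, inner_smul_right, inner_add_right, hy, hself he'n, norm_mul, hc1]
      simp
    have hl0 : ⟪e, v⟫_ℂ ≠ 0 := by rw [← norm_ne_zero_iff, hl]; exact one_ne_zero
    have hx : ⟪e, (⟪e, v⟫_ℂ)⁻¹ • v - e⟫_ℂ = 0 := by
      rw [inner_sub_right, inner_smul_right, inv_mul_cancel₀ hl0, hself he, sub_self]
    refine ⟨_, hx, ?_⟩
    set x := (⟪e, v⟫_ℂ)⁻¹ • v - e with hxdef
    have hex : e + x = (⟪e, v⟫_ℂ)⁻¹ • v := by rw [hxdef]; abel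
    obtain ⟨d, hd1, hd⟩ := exists_phase_smul_eq_of_norm_inner_eq (v := F v) (w := F (e + x))
      (by rw [hFn, hFn, hex, norm_smul, norm_inv, hl]; simp)
      (by rw [hF, hFn, hex, inner_smul_right, norm_mul, norm_inv, hl]
          simp [inner_self_eq_norm_sq_to_K])
    have h1 : e' + T x = ((⟪e', F (e + x)⟫_ℂ)⁻¹ * (d * c)) • (e' + y) := by
      rw [hTe x, hd, hv, smul_smul, smul_smul, mul_assoc]
    have h2 := congrArg (fun u => ⟪e', u⟫_ℂ) h1
    simp only [inner_add_right, inner_smul_right, hTperp x hx, hy, hself he'n, add_zero,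
      mul_one] at h2
    rw [← h2, one_smul] at h1
    exact add_left_cancel h1
  obtain ⟨σ, hσ, hTσ⟩ := exists_ringHom_map_smul hTre hTn
  have hσn : ∀ z, ‖σ z‖ = ‖z‖ := by rcases hσ with rfl | rfl <;> simp
  have hσσ : ∀ z, σ (σ z) = z := by rcases hσ with rfl | rfl <;> simp
  have hproj : ∀ v, ⟪e, v - ⟪e, v⟫_ℂ • e⟫_ℂ = 0 := fun v => by
    rw [inner_sub_right, inner_smul_right, hself he, mul_one, sub_self]
  have hpyth : ∀ {u x : E} (c : ℂ), ‖u‖ = 1 → ⟪u, x⟫_ℂ = 0 →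
      ‖c • u + x‖ ^ 2 = ‖c‖ ^ 2 + ‖x‖ ^ 2 := fun {u x} c hu hx => by
    have := norm_add_sq_eq_norm_sq_add_norm_sq_of_inner_eq_zero (𝕜 := ℂ) (c • u) x
      (by rw [inner_smul_left, hx, mul_zero])
    rw [norm_smul, hu, mul_one] at this
    rw [sq, sq, sq, this]
  let U : E → E := fun v => σ ⟪e, v⟫_ℂ • e' + T (v - ⟪e, v⟫_ℂ • e)
  have hUnorm : ∀ x, ‖U x‖ = ‖x‖ := by
    intro x
    rw [← sq_eq_sq₀ (norm_nonneg _) (norm_nonneg _)]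
    conv_rhs => rw [← add_sub_cancel (⟪e, x⟫_ℂ • e) x]
    rw [hpyth _ he (hproj x), hpyth _ he'n (hTperp _ (hproj x)), hσn, hTnorm _ (hproj x)]
  have hUadd : ∀ x y, U (x + y) = U x + U y := by
    intro x y
    have : x + y - ⟪e, x + y⟫_ℂ • e = (x - ⟪e, x⟫_ℂ • e) + (y - ⟪e, y⟫_ℂ • e) := by
      rw [inner_add_right, add_smul]; abel
    simp only [U]
    rw [this, map_add_of_re_inner_eq hTre (hproj x) (hproj y), inner_add_right, map_add, add_smul]
    abel
  have hUsmul : ∀ (c : ℂ) x, U (c • x) = σ c • U x := by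
    intro c x
    have : c • x - ⟪e, c • x⟫_ℂ • e = c • (x - ⟪e, x⟫_ℂ • e) := by
      rw [inner_smul_right, smul_sub, smul_smul]
    simp only [U]
    rw [this, hTσ c _ (hproj x), inner_smul_right, map_mul, smul_add, smul_smul]
  refine ⟨U, hUadd, hUnorm, fun y => ?_, ?_, fun v => ?_⟩
  · obtain ⟨x, hx, hxy⟩ := hTsurj (y - ⟪e', y⟫_ℂ • e') (by
      rw [inner_sub_right, inner_smul_right, hself he'n, mul_one, sub_self])
    refine ⟨σ ⟪e', y⟫_ℂ • e + x, ?_⟩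
    have h1 : ⟪e, σ ⟪e', y⟫_ℂ • e + x⟫_ℂ = σ ⟪e', y⟫_ℂ := by
      rw [inner_add_right, inner_smul_right, hself he, hx]; simp
    simp only [U]
    rw [h1, hσσ, add_sub_cancel_left, hxy, add_sub_cancel]
  · rcases hσ with rfl | rfl
    · exact Or.inl hUsmul
    · exact Or.inr hUsmul
  · by_cases hl : ⟪e, v⟫_ℂ = 0
    · have : U v = T v := by simp [U, hl]
      rw [this]
      exact hTF v hl
    apply exists_phase_smul_eq_of_norm_inner_eq
    · rw [hFn, hUnorm]
    · set x := (⟪e, v⟫_ℂ)⁻¹ • (v - ⟪e, v⟫_ℂ • e) with hxdef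
      have hx : ⟪e, x⟫_ℂ = 0 := by rw [hxdef, inner_smul_right, hproj, mul_zero]
      have hvx : v = ⟪e, v⟫_ℂ • (e + x) := by
        rw [hxdef, smul_add, smul_smul, mul_inv_cancel₀ hl, one_smul, add_sub_cancel]
      have hUex : U (e + x) = e' + T x := by
        simp only [U]
        rw [inner_add_right, hself he, hx, add_zero, map_one, one_smul, one_smul,
          add_sub_cancel_left]
      have hU : U v = (σ ⟪e, v⟫_ℂ * (⟪e', F (e + x)⟫_ℂ)⁻¹) • F (e + x) := by
        conv_lhs => rw [hvx]
        rw [hUsmul, hUex, hTe, smul_smul]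
      have h3 : ‖⟪v, v⟫_ℂ‖ = ‖⟪e, v⟫_ℂ‖ * ‖⟪v, e + x⟫_ℂ‖ := by
        conv_lhs => rw [hvx, inner_smul_right, ← hvx]
        rw [norm_mul]
      rw [hU, inner_smul_right, norm_mul, norm_mul, norm_inv, hc x hx, hσn, hF, hFn, inv_one,
        mul_one, ← h3]
      simp [inner_self_eq_norm_sq_to_K]

end Wigner

section Expansive

variable {E : Type*} [NormedAddCommGroup E] [InnerProductSpace ℂ E]

theorem norm_sq_smul_add_smul {e₁ e₂ : E} (h₁ : ‖e₁‖ = 1) (h₂ : ‖e₂‖ = 1)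
    (h₁₂ : ⟪e₁, e₂⟫_ℂ = 0) (a b : ℂ) :
    ‖a • e₁ + b • e₂‖ ^ 2 = ‖a‖ ^ 2 + ‖b‖ ^ 2 := by
  have := norm_add_sq_eq_norm_sq_add_norm_sq_of_inner_eq_zero (𝕜 := ℂ) (a • e₁) (b • e₂)
    (by rw [inner_smul_left, inner_smul_right, h₁₂, mul_zero, mul_zero])
  rw [norm_smul, norm_smul, h₁, h₂, mul_one, mul_one] at this
  rw [sq, sq, sq, this]

theorem inner_left_smul_add_smul {e₁ e₂ : E} (h₁ : ‖e₁‖ = 1)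
    (h₁₂ : ⟪e₁, e₂⟫_ℂ = 0) (a b : ℂ) : ⟪e₁, a • e₁ + b • e₂⟫_ℂ = a := by
  rw [inner_add_right, inner_smul_right, inner_smul_right, h₁₂, inner_self_eq_ofReal_norm_sq, h₁]
  simp

theorem inner_right_smul_add_smul {e₁ e₂ : E} (h₂ : ‖e₂‖ = 1)
    (h₁₂ : ⟪e₁, e₂⟫_ℂ = 0) (a b : ℂ) : ⟪e₂, a • e₁ + b • e₂⟫_ℂ = b := by
  rw [add_comm]
  exact inner_left_smul_add_smul h₂ (inner_eq_zero_symm.1 h₁₂) b a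

/-- Equality in the Bessel inequality for an orthonormal pair. -/
theorem eq_inner_smul_add_of_le {e₁ e₂ v : E} (h₁ : ‖e₁‖ = 1) (h₂ : ‖e₂‖ = 1)
    (h₁₂ : ⟪e₁, e₂⟫_ℂ = 0) (hv : ‖v‖ ^ 2 ≤ ‖⟪e₁, v⟫_ℂ‖ ^ 2 + ‖⟪e₂, v⟫_ℂ‖ ^ 2) :
    v = ⟪e₁, v⟫_ℂ • e₁ + ⟪e₂, v⟫_ℂ • e₂ := by
  set p := ⟪e₁, v⟫_ℂ • e₁ + ⟪e₂, v⟫_ℂ • e₂ with hp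
  have hp1 : ⟪e₁, v - p⟫_ℂ = 0 := by
    rw [inner_sub_right, hp, inner_left_smul_add_smul h₁ h₁₂, sub_self]
  have hp2 : ⟪e₂, v - p⟫_ℂ = 0 := by
    rw [inner_sub_right, hp, inner_right_smul_add_smul h₂ h₁₂, sub_self]
  have hpp : ⟪p, v - p⟫_ℂ = 0 := by
    conv_lhs => rw [hp, inner_add_left, inner_smul_left, inner_smul_left, ← hp, hp1, hp2]
    simp
  have h := norm_add_sq_eq_norm_sq_add_norm_sq_of_inner_eq_zero (𝕜 := ℂ) p (v - p) hpp
  rw [add_sub_cancel, ← sq, ← sq, ← sq, hp, norm_sq_smul_add_smul h₁ h₂ h₁₂, ← hp] at h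
  have h0 : ‖v - p‖ ^ 2 = 0 := le_antisymm (by linarith) (sq_nonneg _)
  rw [sq_eq_zero_iff, norm_eq_zero] at h0
  exact sub_eq_zero.1 h0

theorem inner_smul_add_mul_smul {e₁ e₂ : E} (h₁ : ‖e₁‖ = 1) (h₂ : ‖e₂‖ = 1)
    (h₁₂ : ⟪e₁, e₂⟫_ℂ = 0) (a z w : ℂ) (b : ℝ) :
    ⟪a • e₁ + ((b : ℂ) * z) • e₂, a • e₁ + ((b : ℂ) * w) • e₂⟫_ℂ =
      ((‖a‖ ^ 2 : ℝ) : ℂ) + ((b ^ 2 : ℝ) : ℂ) * (conj z * w) := by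
  rw [inner_add_left, inner_smul_left, inner_smul_left, inner_left_smul_add_smul h₁ h₁₂,
    inner_right_smul_add_smul h₂ h₁₂, mul_comm (conj a) a, Complex.mul_conj, map_mul,
    Complex.conj_ofReal, Complex.normSq_eq_norm_sq]
  push_cast
  ring

theorem re_le_re_of_norm_add_mul_le {A B : ℝ} (hA : 0 < A) (hB : 0 < B) {u w : ℂ}
    (hu : ‖u‖ = ‖w‖) (h : ‖(A : ℂ) + B * u‖ ≤ ‖(A : ℂ) + B * w‖) : u.re ≤ w.re := by
  have h1 := congrArg (· ^ 2) hu
  have h2 := pow_le_pow_left₀ (norm_nonneg _) h 2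
  simp only [← Complex.normSq_eq_norm_sq, Complex.normSq_apply, Complex.add_re, Complex.add_im,
    Complex.ofReal_re, Complex.ofReal_im, Complex.re_ofReal_mul, Complex.im_ofReal_mul] at h1 h2
  have h3 : (A * B) * u.re ≤ (A * B) * w.re := by
    have := congrArg (B ^ 2 * ·) h1
    linarith
  exact le_of_mul_le_mul_left h3 (mul_pos hA hB)

theorem norm_sub_sq_of_norm_one {z w : ℂ} (hz : ‖z‖ = 1) (hw : ‖w‖ = 1) :
    ‖z - w‖ ^ 2 = 2 - 2 * (conj z * w).re := by
  have h1 := congrArg (· ^ 2) hz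
  have h2 := congrArg (· ^ 2) hw
  simp only [← Complex.normSq_eq_norm_sq, Complex.normSq_apply, Complex.sub_re, Complex.sub_im,
    Complex.mul_re, Complex.conj_re, Complex.conj_im] at h1 h2 ⊢
  linarith

/-- A map of unit vectors that does not increase transition probabilities and is surjective on
rays preserves transition probabilities. -/
theorem norm_inner_eq_of_norm_inner_le (F G : E → E)
    (hFn : ∀ v, ‖v‖ = 1 → ‖F v‖ = 1) (hGn : ∀ v, ‖v‖ = 1 → ‖G v‖ = 1)
    (hle : ∀ v w, ‖v‖ = 1 → ‖w‖ = 1 → ‖⟪F v, F w⟫_ℂ‖ ≤ ‖⟪v, w⟫_ℂ‖)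
    (hray : ∀ v (c : ℂ), ‖v‖ = 1 → ‖c‖ = 1 → ∃ d : ℂ, ‖d‖ = 1 ∧ F (c • v) = d • F v)
    (hG : ∀ w, ‖w‖ = 1 → ∃ c : ℂ, ‖c‖ = 1 ∧ F (G w) = c • w)
    {x y : E} (hx : ‖x‖ = 1) (hy : ‖y‖ = 1) : ‖⟪F y, F x⟫_ℂ‖ = ‖⟪y, x⟫_ℂ‖ := by
  have hself : ∀ {u : E}, ‖u‖ = 1 → ⟪u, u⟫_ℂ = 1 := fun {u} hu => by
    simp [hu]
  set a := ⟪y, x⟫_ℂ with ha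
  by_cases ha0 : a = 0
  · have := hle y x hy hx
    rw [← ha, ha0, norm_zero] at this
    rw [ha0, norm_zero]
    exact le_antisymm this (norm_nonneg _)
  by_cases hb0 : ‖x - a • y‖ = 0
  · rw [norm_eq_zero, sub_eq_zero] at hb0
    have ha1 : ‖a‖ = 1 := by rw [hb0, norm_smul, hy, mul_one] at hx; exact hx
    obtain ⟨d, hd, hdx⟩ := hray y a hy ha1
    rw [← hb0] at hdx
    rw [hdx, inner_smul_right, hself (hFn y hy), mul_one, hd, ha1]
  set b := ‖x - a • y‖ with hb
  have hbpos : 0 < b := lt_of_le_of_ne (norm_nonneg _) (Ne.symm hb0)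
  have hbC : (b : ℂ) ≠ 0 := by exact_mod_cast hb0
  have hapos : 0 < ‖a‖ := norm_pos_iff.2 ha0
  obtain ⟨e₂, he₂, he₁₂, hxe⟩ : ∃ e₂ : E, ‖e₂‖ = 1 ∧ ⟪y, e₂⟫_ℂ = 0 ∧ x = a • y + (b : ℂ) • e₂ := by
    refine ⟨(b : ℂ)⁻¹ • (x - a • y), ?_, ?_, ?_⟩
    · rw [norm_smul, ← hb, norm_inv, Complex.norm_real, Real.norm_of_nonneg hbpos.le,
        inv_mul_cancel₀ hb0]
    · rw [inner_smul_right, inner_sub_right, inner_smul_right, hself hy, ← ha, mul_one, sub_self,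
        mul_zero]
    · rw [smul_smul, mul_inv_cancel₀ hbC, one_smul, add_sub_cancel]
  have hab : ‖a‖ ^ 2 + b ^ 2 = 1 := by
    have := norm_sq_smul_add_smul hy he₂ he₁₂ a b
    rw [← hxe, hx, Complex.norm_real, Real.norm_of_nonneg hbpos.le] at this
    linarith
  have hq₁ := hFn y hy
  have hq₂ := hFn e₂ he₂
  have hq₁₂ : ⟪F y, F e₂⟫_ℂ = 0 := by
    have := hle y e₂ hy he₂
    rw [he₁₂, norm_zero] at this
    exact norm_eq_zero.1 (le_antisymm this (norm_nonneg _))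
  have hG1 : ∀ v w, ‖v‖ = 1 → ‖w‖ = 1 → ‖⟪F v, w⟫_ℂ‖ ≤ ‖⟪v, G w⟫_ℂ‖ := by
    intro v w hv hw
    obtain ⟨c, hc, hcw⟩ := hG w hw
    have := hle v (G w) hv (hGn w hw)
    rwa [hcw, inner_smul_right, norm_mul, hc, one_mul] at this
  have hG2 : ∀ w w', ‖w‖ = 1 → ‖w'‖ = 1 → ‖⟪w, w'⟫_ℂ‖ ≤ ‖⟪G w, G w'⟫_ℂ‖ := by
    intro w w' hw hw'
    obtain ⟨c, hc, hcw⟩ := hG w hw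
    have := hG1 (G w) w' (hGn w hw) hw'
    rwa [hcw, inner_smul_left, norm_mul, RCLike.norm_conj, hc, one_mul] at this
  let W : ℂ → E := fun z => a • F y + ((b : ℂ) * z) • F e₂
  have hW : ∀ z, ‖z‖ = 1 → ‖W z‖ = 1 := by
    intro z hz
    have := norm_sq_smul_add_smul hq₁ hq₂ hq₁₂ a (b * z)
    rw [norm_mul, hz, Complex.norm_real, Real.norm_of_nonneg hbpos.le, mul_one, hab] at this
    exact (sq_eq_sq₀ (norm_nonneg _) zero_le_one).1 (by rw [one_pow]; exact this)
  let α : ℂ → ℂ := fun z => ⟪y, G (W z)⟫_ℂ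
  let β : ℂ → ℂ := fun z => ⟪e₂, G (W z)⟫_ℂ
  have hα' : ∀ z, ‖z‖ = 1 → ‖a‖ ≤ ‖α z‖ := fun z hz => by
    have := hG1 y (W z) hy (hW z hz)
    rwa [inner_left_smul_add_smul hq₁ hq₁₂] at this
  have hβ' : ∀ z, ‖z‖ = 1 → b ≤ ‖β z‖ := fun z hz => by
    have := hG1 e₂ (W z) he₂ (hW z hz)
    rwa [inner_right_smul_add_smul hq₂ hq₁₂, norm_mul, hz, mul_one, Complex.norm_real,
      Real.norm_of_nonneg hbpos.le] at this
  have hGW : ∀ z, ‖z‖ = 1 → G (W z) = α z • y + β z • e₂ := fun z hz => by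
    apply eq_inner_smul_add_of_le hy he₂ he₁₂
    rw [hGn _ (hW z hz), one_pow, ← hab]
    exact add_le_add (pow_le_pow_left₀ hapos.le (hα' z hz) 2)
      (pow_le_pow_left₀ hbpos.le (hβ' z hz) 2)
  have hαβ : ∀ z, ‖z‖ = 1 → ‖α z‖ ^ 2 + ‖β z‖ ^ 2 = 1 := fun z hz => by
    rw [← norm_sq_smul_add_smul hy he₂ he₁₂, ← hGW z hz, hGn _ (hW z hz), one_pow]
  have hα : ∀ z, ‖z‖ = 1 → ‖α z‖ = ‖a‖ := fun z hz => by
    have h1 := hαβ z hz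
    have h2 := hα' z hz
    have h3 := hβ' z hz
    nlinarith
  have hβ : ∀ z, ‖z‖ = 1 → ‖β z‖ = b := fun z hz => by
    have h1 := hαβ z hz
    have h2 := hα' z hz
    have h3 := hβ' z hz
    nlinarith
  have hα0 : ∀ z, ‖z‖ = 1 → α z ≠ 0 := fun z hz => by
    rw [← norm_pos_iff, hα z hz]; exact hapos
  let f : ℂ → ℂ := fun z => a * β z / (α z * b)
  have hf : ∀ z, ‖z‖ = 1 → ‖f z‖ = 1 := fun z hz => by
    simp only [f]
    rw [norm_div, norm_mul, norm_mul, hα z hz, hβ z hz, Complex.norm_real,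
      Real.norm_of_nonneg hbpos.le, div_self (mul_pos hapos hbpos).ne']
  have hGf : ∀ z, ‖z‖ = 1 → G (W z) = (α z / a) • (a • y + ((b : ℂ) * f z) • e₂) := by
    intro z hz
    have h0 := hα0 z hz
    rw [hGW z hz, smul_add, smul_smul, smul_smul]
    congr 2
    · rw [div_mul_cancel₀ _ ha0]
    · simp only [f]
      field_simp
  have hph : ∀ z, ‖z‖ = 1 → ‖α z / a‖ = 1 := fun z hz => by
    rw [norm_div, hα z hz, div_self hapos.ne']
  have hre : ∀ z w, ‖z‖ = 1 → ‖w‖ = 1 → (conj z * w).re ≤ (conj (f z) * f w).re := by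
    intro z w hz hw
    apply re_le_re_of_norm_add_mul_le (pow_pos hapos 2) (pow_pos hbpos 2)
    · simp [hz, hw, hf z hz, hf w hw]
    · rw [← inner_smul_add_mul_smul hq₁ hq₂ hq₁₂, ← inner_smul_add_mul_smul hy he₂ he₁₂]
      have h := hG2 _ _ (hW z hz) (hW w hw)
      rwa [hGf z hz, hGf w hw, inner_smul_left, inner_smul_right, norm_mul, norm_mul,
        RCLike.norm_conj, hph z hz, hph w hw, one_mul, one_mul] at h
  obtain ⟨z, hz, hfz⟩ := exists_preimage_of_injective_on_circle f hf
    (fun z w hz hw => by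
      rw [← sq_le_sq₀ (norm_nonneg _) (norm_nonneg _),
        norm_sub_sq_of_norm_one (hf z hz) (hf w hw), norm_sub_sq_of_norm_one hz hw]
      linarith [hre z w hz hw])
    (fun z w hz hw hzw => by
      have h1 : G (W w) = ((α w / a) * (α z / a)⁻¹) • G (W z) := by
        have h0 : α z / a ≠ 0 := div_ne_zero (hα0 z hz) ha0
        rw [hGf z hz, hGf w hw, hzw, smul_smul, mul_assoc, inv_mul_cancel₀ h0, mul_one]
      obtain ⟨d, hd, hdF⟩ := hray (G (W z)) ((α w / a) * (α z / a)⁻¹) (hGn _ (hW z hz))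
        (by rw [norm_mul, norm_inv, hph z hz, hph w hw]; norm_num)
      obtain ⟨c, hc, hcz⟩ := hG _ (hW z hz)
      obtain ⟨c', hc', hcw⟩ := hG _ (hW w hw)
      rw [← h1, hcz, hcw] at hdF
      have h2 := congrArg (fun u => ‖⟪W z, u⟫_ℂ‖) hdF
      simp only [inner_smul_right, norm_mul, hc, hc', hd, hself (hW z hz), norm_one,
        one_mul] at h2
      have h3 : (conj z * z).re ≤ (conj z * w).re := by
        apply re_le_re_of_norm_add_mul_le (pow_pos hapos 2) (pow_pos hbpos 2)
        · simp [hz, hw]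
        · rw [← inner_smul_add_mul_smul hq₁ hq₂ hq₁₂, ← inner_smul_add_mul_smul hq₁ hq₂ hq₁₂]
          change ‖⟪W z, W z⟫_ℂ‖ ≤ ‖⟪W z, W w⟫_ℂ‖
          rw [h2, hself (hW z hz), norm_one]
      have h4 := norm_sub_sq_of_norm_one hz hw
      have h5 := norm_sub_sq_of_norm_one hz hz
      rw [sub_self, norm_zero] at h5
      have h6 : ‖z - w‖ ^ 2 = 0 := le_antisymm (by linarith) (sq_nonneg _)
      exact sub_eq_zero.1 (norm_eq_zero.1 (sq_eq_zero_iff.1 h6)))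
    (c := 1) norm_one
  have hGx := hGf z hz
  rw [hfz, mul_one, ← hxe] at hGx
  obtain ⟨d, hd, hdF⟩ := hray x (α z / a) hx (hph z hz)
  obtain ⟨c, hc, hcz⟩ := hG _ (hW z hz)
  rw [← hGx, hcz] at hdF
  have h := congrArg (fun u => ‖⟪F y, u⟫_ℂ‖) hdF
  simp only [inner_smul_right, norm_mul, hc, hd, one_mul] at h
  rw [← h, inner_left_smul_add_smul hq₁ hq₁₂]

end Expansive

section Projections

variable {E : Type*} [NormedAddCommGroup E] [InnerProductSpace ℂ E]

theorem rankOneProj_apply (v x : E) : rankOneProj v x = ⟪v, x⟫_ℂ • v := rfl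

theorem rankOneProj_smul {c : ℂ} (hc : ‖c‖ = 1) (v : E) :
    rankOneProj (c • v) = rankOneProj v := by
  ext x
  rw [rankOneProj_apply, rankOneProj_apply, inner_smul_left, smul_smul, mul_right_comm,
    mul_comm (conj c) c, Complex.mul_conj, Complex.normSq_eq_norm_sq, hc]
  simp

theorem exists_phase_of_rankOneProj_eq {v w : E} (hv : ‖v‖ = 1) (hw : ‖w‖ = 1)
    (h : rankOneProj v = rankOneProj w) : ∃ c : ℂ, ‖c‖ = 1 ∧ v = c • w := by
  have h1 : rankOneProj v v = rankOneProj w v := by rw [h]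
  rw [rankOneProj_apply, rankOneProj_apply, inner_self_eq_ofReal_norm_sq, hv, one_pow,
    Complex.ofReal_one, one_smul] at h1
  refine ⟨_, ?_, h1⟩
  have h2 := congrArg norm h1
  rw [norm_smul, hv, hw, mul_one] at h2
  exact h2.symm

theorem isRankOneProjection_rankOneProj {v : H} (hv : ‖v‖ = 1) :
    IsRankOneProjection (rankOneProj v) := by
  have hvv : ⟪v, v⟫_ℂ = 1 := by simp [hv]
  refine ⟨?_, ?_, ?_⟩
  · rw [ContinuousLinearMap.isSelfAdjoint_iff_isSymmetric]
    intro x y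
    change ⟪rankOneProj v x, y⟫_ℂ = ⟪x, rankOneProj v y⟫_ℂ
    rw [rankOneProj_apply, rankOneProj_apply, inner_smul_left, inner_smul_right, inner_conj_symm,
      mul_comm]
  · ext x
    change rankOneProj v (rankOneProj v x) = rankOneProj v x
    simp only [rankOneProj_apply, inner_smul_right, hvv, mul_one]
  · have hr : LinearMap.range (rankOneProj v : H →ₗ[ℂ] H) = ℂ ∙ v := by
      ext x
      rw [LinearMap.mem_range, Submodule.mem_span_singleton]
      constructor
      · rintro ⟨y, rfl⟩
        exact ⟨⟪v, y⟫_ℂ, rfl⟩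
      · rintro ⟨c, rfl⟩
        refine ⟨c • v, ?_⟩
        change rankOneProj v (c • v) = c • v
        rw [rankOneProj_apply, inner_smul_right, hvv, mul_one]
    rw [hr]
    exact finrank_span_singleton (by rintro rfl; simp at hv)

theorem IsRankOneProjection.exists_eq_rankOneProj {P : H →L[ℂ] H} (hP : IsRankOneProjection P) :
    ∃ v : H, ‖v‖ = 1 ∧ P = rankOneProj v := by
  obtain ⟨hsa, hid, hrank⟩ := hP
  obtain ⟨⟨u, hu⟩, hu0, hspan⟩ := finrank_eq_one_iff'.1 hrank
  have hu0' : u ≠ 0 := fun h => hu0 (Subtype.ext h)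
  have hun : ‖u‖ ≠ 0 := norm_ne_zero_iff.2 hu0'
  have hmul : ∀ x, ∃ c : ℂ, P x = c • u := fun x => by
    obtain ⟨c, hc⟩ := hspan ⟨P x, x, rfl⟩
    exact ⟨c, (congrArg Subtype.val hc).symm⟩
  have hPu : P u = u := by
    obtain ⟨x, rfl⟩ := hu
    exact congrArg (fun A : H →L[ℂ] H => A x) hid
  have hsymm := (ContinuousLinearMap.isSelfAdjoint_iff_isSymmetric (A := P)).1 hsa
  set v : H := ((‖u‖ : ℂ)⁻¹) • u with hvdef
  have hv : ‖v‖ = 1 := by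
    rw [hvdef, norm_smul, norm_inv, Complex.norm_real, norm_norm, inv_mul_cancel₀ hun]
  have hvv : ⟪v, v⟫_ℂ = 1 := by simp [hv]
  have huv : u = (‖u‖ : ℂ) • v := by
    rw [hvdef, smul_smul, mul_inv_cancel₀ (by exact_mod_cast hun), one_smul]
  have hPv : P v = v := by rw [hvdef, map_smul, hPu]
  refine ⟨v, hv, ?_⟩
  ext x
  obtain ⟨c, hc⟩ := hmul x
  rw [huv, smul_smul] at hc
  have h1 : ⟪v, P x⟫_ℂ = ⟪v, x⟫_ℂ := by
    have : ⟪P v, x⟫_ℂ = ⟪v, P x⟫_ℂ := hsymm v x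
    rw [← this, hPv]
  rw [hc, inner_smul_right, hvv, mul_one] at h1
  rw [rankOneProj_apply, hc, h1]

theorem norm_rankOneProj_sub_sq {v w : H} (hv : ‖v‖ = 1) (hw : ‖w‖ = 1) :
    ‖rankOneProj v - rankOneProj w‖ ^ 2 = 1 - ‖⟪v, w⟫_ℂ‖ ^ 2 := by
  have hvv : ⟪v, v⟫_ℂ = 1 := by simp [hv]
  have hww : ⟪w, w⟫_ℂ = 1 := by simp [hw]
  set A := rankOneProj v - rankOneProj w with hA
  have hAx : ∀ x, A x = ⟪v, x⟫_ℂ • v - ⟪w, x⟫_ℂ • w := fun x => rfl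
  set s : ℝ := 1 - ‖⟪v, w⟫_ℂ‖ ^ 2 with hs
  have hsC : (s : ℂ) = 1 - ⟪v, w⟫_ℂ * ⟪w, v⟫_ℂ := by
    rw [← inner_conj_symm w v, Complex.mul_conj, Complex.normSq_eq_norm_sq, hs]
    push_cast; rfl
  have hs0 : 0 ≤ s := by
    have := norm_inner_le_norm (𝕜 := ℂ) v w
    rw [hv, hw, one_mul] at this
    have := pow_le_one₀ (n := 2) (norm_nonneg _) this
    linarith
  have hAAv : A (A v) = (s : ℂ) • v := by
    rw [hAx v, hvv, hAx, hsC]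
    simp only [inner_sub_right, inner_smul_right, hvv, hww]
    module
  have hAAw : A (A w) = (s : ℂ) • w := by
    rw [hAx w, hww, hAx, hsC]
    simp only [inner_sub_right, inner_smul_right, hvv, hww]
    module
  have hsa : IsSelfAdjoint A :=
    (isRankOneProjection_rankOneProj hv).1.sub (isRankOneProjection_rankOneProj hw).1
  have hcube : A * A * (A * A) = (s : ℂ) • (A * A) := by
    ext x
    change A (A (A (A x))) = (s : ℂ) • A (A x)
    rw [hAx (A x), map_sub, map_sub, map_smul, map_smul, map_smul, map_smul, hAAv, hAAw, smul_sub,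
      smul_comm (s : ℂ), smul_comm (s : ℂ)]
  have hn : ‖A * A‖ = ‖A‖ ^ 2 := hsa.norm_mul_self
  have hsa2 : IsSelfAdjoint (A * A) := by
    rw [← sq]; exact hsa.pow 2
  have hn2 := congrArg norm hcube
  rw [hsa2.norm_mul_self, hn, norm_smul, hn, Complex.norm_real, Real.norm_of_nonneg hs0, sq] at hn2
  by_cases hA0 : ‖A‖ ^ 2 = 0
  · have hA00 : A = 0 := norm_eq_zero.1 (sq_eq_zero_iff.1 hA0)
    have hv0 : v ≠ 0 := by rintro rfl; simp at hv
    have : (s : ℂ) • v = 0 := by rw [← hAAv, hA00]; rfl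
    have h0 : s = 0 := by simpa [hv0] using this
    rw [hA0, h0]
  · exact mul_right_cancel₀ hA0 hn2

theorem norm_inner_le_of_norm_rankOneProj_sub_le {v w v' w' : H} (hv : ‖v‖ = 1) (hw : ‖w‖ = 1)
    (hv' : ‖v'‖ = 1) (hw' : ‖w'‖ = 1)
    (h : ‖rankOneProj v - rankOneProj w‖ ≤ ‖rankOneProj v' - rankOneProj w'‖) :
    ‖⟪v', w'⟫_ℂ‖ ≤ ‖⟪v, w⟫_ℂ‖ := by
  have h2 := pow_le_pow_left₀ (norm_nonneg _) h 2
  rw [norm_rankOneProj_sub_sq hv hw, norm_rankOneProj_sub_sq hv' hw'] at h2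
  rw [← sq_le_sq₀ (norm_nonneg _) (norm_nonneg _)]
  linarith

end Projections

/-- Theorem 1.3. If `dim H ≥ 2` and `φ` is a surjective map on the set of
rank-one projections with `‖φ(P) − φ(Q)‖ ≥ ‖P − Q‖` for all `P, Q`, then `φ` is a
Wigner symmetry. -/
theorem surjective_noncontractive_is_wigner
    (hdim : 2 ≤ Module.rank ℂ H)
    (φ : {P : H →L[ℂ] H // IsRankOneProjection P} → {P : H →L[ℂ] H // IsRankOneProjection P})
    (hsurj : Function.Surjective φ)
    (hnc : ∀ P Q : {P : H →L[ℂ] H // IsRankOneProjection P},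
      ‖(φ P).1 - (φ Q).1‖ ≥ ‖P.1 - Q.1‖) :
    IsWignerSymmetry φ := by
  have hrep : ∀ v : H, ∃ w : H, ∀ hv : ‖v‖ = 1,
      ‖w‖ = 1 ∧ (φ ⟨_, isRankOneProjection_rankOneProj hv⟩).1 = rankOneProj w := fun v => by
    by_cases hv : ‖v‖ = 1
    · obtain ⟨w, hw⟩ := (φ ⟨_, isRankOneProjection_rankOneProj hv⟩).2.exists_eq_rankOneProj
      exact ⟨w, fun _ => hw⟩
    · exact ⟨0, fun h => absurd h hv⟩
  choose F hF using hrep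
  have hinv : ∀ w : H, ∃ v : H, ‖w‖ = 1 → ‖v‖ = 1 ∧ ∃ c : ℂ, ‖c‖ = 1 ∧ F v = c • w := fun w => by
    by_cases hw : ‖w‖ = 1
    · obtain ⟨P, hP⟩ := hsurj ⟨_, isRankOneProjection_rankOneProj hw⟩
      obtain ⟨v, hv, hPv⟩ := P.2.exists_eq_rankOneProj
      refine ⟨v, fun _ => ⟨hv, exists_phase_of_rankOneProj_eq (hF v hv).1 hw ?_⟩⟩
      have hPeq : P = ⟨_, isRankOneProjection_rankOneProj hv⟩ := Subtype.ext hPv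
      rw [← (hF v hv).2, ← hPeq, hP]
    · exact ⟨0, fun h => absurd h hw⟩
  choose G hG using hinv
  have hFn : ∀ v, ‖v‖ = 1 → ‖F v‖ = 1 := fun v hv => (hF v hv).1
  have hray : ∀ v (c : ℂ), ‖v‖ = 1 → ‖c‖ = 1 → ∃ d : ℂ, ‖d‖ = 1 ∧ F (c • v) = d • F v := by
    intro v c hv hc
    have hcv : ‖c • v‖ = 1 := by rw [norm_smul, hc, hv, one_mul]
    apply exists_phase_of_rankOneProj_eq (hFn _ hcv) (hFn _ hv)
    rw [← (hF _ hcv).2, ← (hF v hv).2]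
    congr 2
    exact Subtype.ext (rankOneProj_smul hc v)
  have hiso : ∀ {x y}, ‖x‖ = 1 → ‖y‖ = 1 → ‖⟪F y, F x⟫_ℂ‖ = ‖⟪y, x⟫_ℂ‖ := by
    intro x y hx hy
    refine norm_inner_eq_of_norm_inner_le F G hFn (fun w hw => (hG w hw).1) ?_ hray
      (fun w hw => (hG w hw).2) hx hy
    intro v w hv hw
    apply norm_inner_le_of_norm_rankOneProj_sub_le hv hw (hFn v hv) (hFn w hw)
    have h := hnc ⟨_, isRankOneProjection_rankOneProj hv⟩ ⟨_, isRankOneProjection_rankOneProj hw⟩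
    rwa [(hF v hv).2, (hF w hw).2] at h
  have hnormalize : ∀ x : H, x ≠ 0 → ‖((‖x‖ : ℂ))⁻¹ • x‖ = 1 := fun x hx => by
    rw [norm_smul, norm_inv, Complex.norm_real, norm_norm,
      inv_mul_cancel₀ (norm_ne_zero_iff.2 hx)]
  have : Nontrivial H := by
    rw [← rank_pos_iff_nontrivial (R := ℂ)]
    exact lt_of_lt_of_le (by norm_num) hdim
  obtain ⟨e₀, he₀⟩ := exists_ne (0 : H)
  obtain ⟨U, hUadd, hUnorm, hUsurj, hUlin, hUF⟩ := exists_wigner_operator (hnormalize e₀ he₀)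
    (fun x : H => (‖x‖ : ℂ) • F ((‖x‖ : ℂ)⁻¹ • x))
    (fun x y => by
      by_cases hx : x = 0
      · simp [hx]
      by_cases hy : y = 0
      · simp [hy]
      have hx' : ‖x‖ ≠ 0 := norm_ne_zero_iff.2 hx
      have hy' : ‖y‖ ≠ 0 := norm_ne_zero_iff.2 hy
      simp only [inner_smul_left, inner_smul_right, norm_mul,
        hiso (hnormalize y hy) (hnormalize x hx), RCLike.norm_conj, norm_inv, Complex.norm_real,
        norm_norm]
      field_simp)
    (fun w => by
      by_cases hw : w = 0
      · exact ⟨0, 1, norm_one, by simp [hw]⟩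
      have hw' : (‖w‖ : ℂ) ≠ 0 := by exact_mod_cast norm_ne_zero_iff.2 hw
      obtain ⟨hv, c, hc, hcw⟩ := hG _ (hnormalize w hw)
      refine ⟨(‖w‖ : ℂ) • G ((‖w‖ : ℂ)⁻¹ • w), c, hc, ?_⟩
      have hn : ‖(‖w‖ : ℂ) • G ((‖w‖ : ℂ)⁻¹ • w)‖ = ‖w‖ := by
        rw [norm_smul, hv, mul_one, Complex.norm_real, norm_norm]
      simp only [hn]
      rw [inv_smul_smul₀ hw', hcw, smul_comm c, smul_inv_smul₀ hw'])
  refine ⟨U, hUadd, hUnorm, hUsurj, hUlin, fun v hv P hP => ?_⟩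
  obtain ⟨c, hc, hUv⟩ := hUF v
  have hPeq : P = ⟨_, isRankOneProjection_rankOneProj hv⟩ := Subtype.ext hP
  simp only [hv, Complex.ofReal_one, inv_one, one_smul] at hUv
  rw [hPeq, (hF v hv).2, hUv, rankOneProj_smul hc]
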